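/- arXiv:1202.3571 — 11 statements merged into one kernel-verified Lean document; each statement's English description precedes it below -/
import Mathlib

section
/- For every finite no-signalling model satisfying the uniform-settings condition, if the model has free-will parameter at most P with 1/4 ≤ P ≤ 1/3, then its CHSH value S and average guessing probability G satisfy S ≤ 4 − 8·(2G − 1)·(1 − 3P). -/
open Finset

/-- Alice's marginal outcome distribution (computed with Bob's setting `k = 0`;
by no-signalling it is independent of `k`). -/
noncomputable def margA {Λ : Type} (q : Λ → Fin 2 → Fin 2 → Fin 2 → Fin 2 → ℝ)
    (l : Λ) (j a : Fin 2) : ℝ := ∑ b, q l j 0 a b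

/-- Bob's marginal outcome distribution (computed with Alice's setting `j = 0`;
by no-signalling it is independent of `j`). -/
noncomputable def margB {Λ : Type} (q : Λ → Fin 2 → Fin 2 → Fin 2 → Fin 2 → ℝ)
    (l : Λ) (k b : Fin 2) : ℝ := ∑ a, q l 0 k a b

/-- Local guessing probability `G(λ)`: the maximum of all eight marginal probabilities. -/
noncomputable def Gloc {Λ : Type} (q : Λ → Fin 2 → Fin 2 → Fin 2 → Fin 2 → ℝ)
    (l : Λ) : ℝ :=
  max
    (max (max (margA q l 0 0) (margA q l 0 1)) (max (margA q l 1 0) (margA q l 1 1)))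
    (max (max (margB q l 0 0) (margB q l 0 1)) (max (margB q l 1 0) (margB q l 1 1)))

/-- Average guessing probability `G = Σ_λ ρ(λ) G(λ)`. -/
noncomputable def Gavg {Λ : Type} [Fintype Λ] (ρ : Λ → ℝ)
    (q : Λ → Fin 2 → Fin 2 → Fin 2 → Fin 2 → ℝ) : ℝ := ∑ l, ρ l * Gloc q l

/-- Observed distribution `p̃(a,b|A_j,B_k) = 4 Σ_λ ρ(λ) p(A_j,B_k|λ) q(a,b|A_j,B_k,λ)`. -/
noncomputable def ptilde {Λ : Type} [Fintype Λ] (ρ : Λ → ℝ)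
    (p : Λ → Fin 2 → Fin 2 → ℝ) (q : Λ → Fin 2 → Fin 2 → Fin 2 → Fin 2 → ℝ)
    (a b j k : Fin 2) : ℝ := 4 * ∑ l, ρ l * p l j k * q l j k a b

/-- CHSH value `S = |Σ_{a,b,j,k} (-1)^(a+b+jk) p̃(a,b|A_j,B_k)|`. -/
noncomputable def chsh {Λ : Type} [Fintype Λ] (ρ : Λ → ℝ)
    (p : Λ → Fin 2 → Fin 2 → ℝ) (q : Λ → Fin 2 → Fin 2 → Fin 2 → Fin 2 → ℝ) : ℝ :=
  |∑ a : Fin 2, ∑ b : Fin 2, ∑ j : Fin 2, ∑ k : Fin 2,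
      (-1 : ℝ) ^ ((a : ℕ) + (b : ℕ) + (j : ℕ) * (k : ℕ)) * ptilde ρ p q a b j k|

/-- A finite no-signalling model: `ρ` is a probability distribution on `Λ`, each
`p λ` is a probability distribution on settings, each `q λ j k` is a probability
distribution on outcomes, and the marginals satisfy no-signalling. -/
def IsModel {Λ : Type} [Fintype Λ] (ρ : Λ → ℝ) (p : Λ → Fin 2 → Fin 2 → ℝ)
    (q : Λ → Fin 2 → Fin 2 → Fin 2 → Fin 2 → ℝ) : Prop :=
  (∀ l, 0 ≤ ρ l) ∧ (∑ l, ρ l = 1) ∧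
  (∀ l j k, 0 ≤ p l j k) ∧ (∀ l, ∑ j, ∑ k, p l j k = 1) ∧
  (∀ l j k a b, 0 ≤ q l j k a b) ∧ (∀ l j k, ∑ a, ∑ b, q l j k a b = 1) ∧
  (∀ l j k a, ∑ b, q l j k a b = margA q l j a) ∧
  (∀ l j k b, ∑ a, q l j k a b = margB q l k b)

/-- Uniform-settings condition: `Σ_λ ρ(λ) p(A_j,B_k|λ) = 1/4` for all `j,k`. -/
def UniformSettings {Λ : Type} [Fintype Λ] (ρ : Λ → ℝ)
    (p : Λ → Fin 2 → Fin 2 → ℝ) : Prop := ∀ j k, ∑ l, ρ l * p l j k = 1 / 4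

/-- The model has free-will parameter at most `P`. -/
def FreeWillLE {Λ : Type} (ρ : Λ → ℝ) (p : Λ → Fin 2 → Fin 2 → ℝ) (P : ℝ) : Prop :=
  ∀ l, 0 < ρ l → ∀ j k, p l j k ≤ P

/-- The correlator `⟨A_j B_k⟩` of the outcome distribution `q λ j k`. -/
noncomputable def corr {Λ : Type} (q : Λ → Fin 2 → Fin 2 → Fin 2 → Fin 2 → ℝ)
    (l : Λ) (j k : Fin 2) : ℝ :=
  q l j k 0 0 - q l j k 0 1 - q l j k 1 0 + q l j k 1 1

/-- The contribution of the hidden state `λ` to a quarter of the signed CHSH sum. -/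
noncomputable def weightedChsh {Λ : Type} (p : Λ → Fin 2 → Fin 2 → ℝ)
    (q : Λ → Fin 2 → Fin 2 → Fin 2 → Fin 2 → ℝ) (l : Λ) : ℝ :=
  p l 0 0 * corr q l 0 0 + p l 0 1 * corr q l 0 1 + p l 1 0 * corr q l 1 0
    - p l 1 1 * corr q l 1 1

theorem chsh_eq {Λ : Type} [Fintype Λ] (ρ : Λ → ℝ) (p : Λ → Fin 2 → Fin 2 → ℝ)
    (q : Λ → Fin 2 → Fin 2 → Fin 2 → Fin 2 → ℝ) :
    chsh ρ p q = |4 * ∑ l, ρ l * weightedChsh p q l| := by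
  unfold chsh ptilde weightedChsh corr
  congr 1
  simp only [Fin.sum_univ_two, Finset.mul_sum, ← Finset.sum_add_distrib]
  refine Finset.sum_congr rfl fun l _ => ?_
  norm_num
  ring

theorem abs_corr_le_one {Λ : Type} {q : Λ → Fin 2 → Fin 2 → Fin 2 → Fin 2 → ℝ} {l : Λ}
    {j k : Fin 2} (hq : ∀ a b, 0 ≤ q l j k a b) (hsum : ∑ a, ∑ b, q l j k a b = 1) :
    |corr q l j k| ≤ 1 := by
  simp only [Fin.sum_univ_two] at hsum
  have h₀ := hq 0 0
  have h₁ := hq 0 1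
  have h₂ := hq 1 0
  have h₃ := hq 1 1
  rw [corr, abs_le]
  constructor <;> linarith

/-- Monogamy between the local CHSH value and the local guessing probability. -/
theorem abs_corr_chsh_le {Λ : Type} {q : Λ → Fin 2 → Fin 2 → Fin 2 → Fin 2 → ℝ} {l : Λ}
    (hq : ∀ j k a b, 0 ≤ q l j k a b) (hsum : ∀ j k, ∑ a, ∑ b, q l j k a b = 1)
    (hA : ∀ j k a, ∑ b, q l j k a b = margA q l j a)
    (hB : ∀ j k b, ∑ a, q l j k a b = margB q l k b) :
    |corr q l 0 0 + corr q l 0 1 + corr q l 1 0 - corr q l 1 1|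
      ≤ 4 - 2 * (2 * Gloc q l - 1) := by
  set C := |corr q l 0 0 + corr q l 0 1 + corr q l 1 0 - corr q l 1 1| with hC
  suffices h : Gloc q l ≤ (6 - C) / 4 by linarith
  have hmarg : (∀ j a, margA q l j a ≤ (6 - C) / 4) ∧
      ∀ k b, margB q l k b ≤ (6 - C) / 4 := by
    simp only [corr] at hC
    simp only [Fin.forall_fin_two, Fin.sum_univ_two, Fin.isValue] at hq hsum hA hB ⊢
    rcases abs_cases (q l 0 0 0 0 - q l 0 0 0 1 - q l 0 0 1 0 + q l 0 0 1 1
      + (q l 0 1 0 0 - q l 0 1 0 1 - q l 0 1 1 0 + q l 0 1 1 1)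
      + (q l 1 0 0 0 - q l 1 0 0 1 - q l 1 0 1 0 + q l 1 0 1 1)
      - (q l 1 1 0 0 - q l 1 1 0 1 - q l 1 1 1 0 + q l 1 1 1 1)) with h | h <;>
    · rw [h.1] at hC
      refine ⟨⟨⟨?_, ?_⟩, ?_, ?_⟩, ⟨?_, ?_⟩, ?_, ?_⟩ <;> linarith
  obtain ⟨h₁, h₂⟩ := hmarg
  simp only [Gloc, max_le_iff, h₁, h₂, and_self]

theorem abs_weightedChsh_le {Λ : Type} {p : Λ → Fin 2 → Fin 2 → ℝ}
    {q : Λ → Fin 2 → Fin 2 → Fin 2 → Fin 2 → ℝ} {P : ℝ} {l : Λ}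
    (hp : ∑ j, ∑ k, p l j k = 1) (hpP : ∀ j k, p l j k ≤ P) (hP : P ≤ 1 / 3)
    (hq : ∀ j k a b, 0 ≤ q l j k a b) (hsum : ∀ j k, ∑ a, ∑ b, q l j k a b = 1)
    (hA : ∀ j k a, ∑ b, q l j k a b = margA q l j a)
    (hB : ∀ j k b, ∑ a, q l j k a b = margB q l k b) :
    |weightedChsh p q l| ≤ 1 - 2 * (2 * Gloc q l - 1) * (1 - 3 * P) := by
  have hchsh := abs_le.1 (abs_corr_chsh_le hq hsum hA hB)
  have hE := fun j k => abs_le.1 (abs_corr_le_one (hq j k) (hsum j k))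
  have hP₀ : 0 ≤ 1 - 3 * P := by linarith
  have hge : ∀ j k, 0 ≤ p l j k - (1 - 3 * P) := by
    simp only [Fin.forall_fin_two, Fin.sum_univ_two, Fin.isValue] at hp hpP ⊢
    refine ⟨⟨?_, ?_⟩, ?_, ?_⟩ <;> linarith
  have hlo := fun j k => mul_nonneg (hge j k) (neg_le_iff_add_nonneg.1 (hE j k).1)
  have hhi := fun j k => mul_nonneg (hge j k) (sub_nonneg.2 (hE j k).2)
  have hlower := mul_le_mul_of_nonneg_left hchsh.1 hP₀
  have hupper := mul_le_mul_of_nonneg_left hchsh.2 hP₀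
  simp only [Fin.sum_univ_two] at hp
  rw [abs_le, weightedChsh]
  constructor
  · linarith [hlo 0 0, hlo 0 1, hlo 1 0, hhi 1 1]
  · linarith [hhi 0 0, hhi 0 1, hhi 1 0, hlo 1 1]

/-- Theorem 1, general case, upper bound: for every finite
no-signalling model with uniform settings and free-will parameter at most `P`,
`1/4 ≤ P ≤ 1/3`, the CHSH value satisfies `S ≤ 4 - 8(2G-1)(1-3P)`. -/
theorem chsh_le_of_freeWill {Λ : Type} [Fintype Λ] (ρ : Λ → ℝ)
    (p : Λ → Fin 2 → Fin 2 → ℝ) (q : Λ → Fin 2 → Fin 2 → Fin 2 → Fin 2 → ℝ)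
    (P : ℝ) (hmodel : IsModel ρ p q) (hunif : UniformSettings ρ p)
    (hfw : FreeWillLE ρ p P) (hP : 1 / 4 ≤ P) (hP' : P ≤ 1 / 3) :
    chsh ρ p q ≤ 4 - 8 * (2 * Gavg ρ q - 1) * (1 - 3 * P) := by
  obtain ⟨hρ, hρ₁, -, hp, hq, hsum, hA, hB⟩ := hmodel
  have hterm : ∀ l, |ρ l * weightedChsh p q l|
      ≤ ρ l * (1 - 2 * (2 * Gloc q l - 1) * (1 - 3 * P)) := by
    intro l
    rw [abs_mul, abs_of_nonneg (hρ l)]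
    rcases (hρ l).eq_or_lt with h | h
    · simp [← h]
    · exact mul_le_mul_of_nonneg_left
        (abs_weightedChsh_le (hp l) (hfw l h) hP' (hq l) (hsum l) (hA l) (hB l)) h.le
  have htotal : ∑ l, ρ l * (1 - 2 * (2 * Gloc q l - 1) * (1 - 3 * P))
      = 1 - 2 * (2 * Gavg ρ q - 1) * (1 - 3 * P) := by
    have hsplit : ∀ l, ρ l * (1 - 2 * (2 * Gloc q l - 1) * (1 - 3 * P))
        = ρ l * (1 + 2 * (1 - 3 * P)) - ρ l * Gloc q l * (4 * (1 - 3 * P)) := fun l => by ring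
    simp only [hsplit, Finset.sum_sub_distrib, ← Finset.sum_mul, hρ₁, Gavg]
    ring
  have hle := (Finset.abs_sum_le_sum_abs (fun l => ρ l * weightedChsh p q l) univ).trans
    (Finset.sum_le_sum fun l _ => hterm l)
  rw [htotal] at hle
  rw [chsh_eq, abs_mul, abs_of_pos (by norm_num : (0 : ℝ) < 4)]
  linarith
end

section
/- For every real P with 1/3 ≤ P ≤ 1 there exists a finite no-signalling model satisfying the uniform-settings condition, with free-will parameter at most P, with all outcome probabilities q λ j k a b equal to 0 or 1 (hence average guessing probability G = 1), and with CHSH value S = 4. -/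
open Finset

/-- The outcome distribution in which Alice answers `f l j` and Bob answers `g l k`. -/
def deterministicOutcome {Λ : Type} (f g : Λ → Fin 2 → Fin 2)
    (l : Λ) (j k a b : Fin 2) : ℝ :=
  (if a = f l j then 1 else 0) * (if b = g l k then 1 else 0)

section Deterministic

variable {Λ : Type} (f g : Λ → Fin 2 → Fin 2)

lemma deterministicOutcome_eq_zero_or_one (l : Λ) (j k a b : Fin 2) :
    deterministicOutcome f g l j k a b = 0 ∨ deterministicOutcome f g l j k a b = 1 := by
  unfold deterministicOutcome
  split_ifs <;> simp

lemma sum_deterministicOutcome_right (l : Λ) (j k a : Fin 2) :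
    ∑ b, deterministicOutcome f g l j k a b = if a = f l j then 1 else 0 := by
  simp [deterministicOutcome]

lemma sum_deterministicOutcome_left (l : Λ) (j k b : Fin 2) :
    ∑ a, deterministicOutcome f g l j k a b = if b = g l k then 1 else 0 := by
  simp [deterministicOutcome]

lemma margA_deterministicOutcome (l : Λ) (j a : Fin 2) :
    margA (deterministicOutcome f g) l j a = if a = f l j then 1 else 0 :=
  sum_deterministicOutcome_right f g l j 0 a

lemma margB_deterministicOutcome (l : Λ) (k b : Fin 2) :
    margB (deterministicOutcome f g) l k b = if b = g l k then 1 else 0 :=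
  sum_deterministicOutcome_left f g l 0 k b

lemma Gloc_deterministicOutcome (l : Λ) : Gloc (deterministicOutcome f g) l = 1 := by
  have max_indicator (x : Fin 2) :
      max (if 0 = x then (1 : ℝ) else 0) (if 1 = x then 1 else 0) = 1 := by
    fin_cases x <;> simp
  simp only [Gloc, margA_deterministicOutcome, margB_deterministicOutcome, max_indicator, max_self]

lemma Gavg_deterministicOutcome [Fintype Λ] (ρ : Λ → ℝ) :
    Gavg ρ (deterministicOutcome f g) = ∑ l, ρ l := by
  simp [Gavg, Gloc_deterministicOutcome]

lemma isModel_deterministicOutcome [Fintype Λ] {ρ : Λ → ℝ} {p : Λ → Fin 2 → Fin 2 → ℝ}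
    (hρ : ∀ l, 0 ≤ ρ l) (hρ_sum : ∑ l, ρ l = 1) (hp : ∀ l j k, 0 ≤ p l j k)
    (hp_sum : ∀ l, ∑ j, ∑ k, p l j k = 1) : IsModel ρ p (deterministicOutcome f g) := by
  refine ⟨hρ, hρ_sum, hp, hp_sum, fun l j k a b => ?_, fun l j k => ?_, fun l j k a => ?_,
    fun l j k b => ?_⟩
  · rcases deterministicOutcome_eq_zero_or_one f g l j k a b with h | h <;> simp [h]
  · simp only [sum_deterministicOutcome_right, sum_ite_eq', mem_univ, if_true]
  · rw [sum_deterministicOutcome_right, margA_deterministicOutcome]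
  · rw [sum_deterministicOutcome_left, margB_deterministicOutcome]

/-- If the answers win the CHSH game on every settings pair that can occur, then `S = 4`. -/
lemma chsh_deterministicOutcome_eq_four [Fintype Λ] {ρ : Λ → ℝ} {p : Λ → Fin 2 → Fin 2 → ℝ}
    (hρ_sum : ∑ l, ρ l = 1) (hp_sum : ∀ l, ∑ j, ∑ k, p l j k = 1)
    (hwin : ∀ l j k, p l j k ≠ 0 → f l j + g l k = j * k) :
    chsh ρ p (deterministicOutcome f g) = 4 := by
  have correlation (l : Λ) (j k : Fin 2) :
      ∑ a : Fin 2, ∑ b : Fin 2, (-1 : ℝ) ^ ((a : ℕ) + (b : ℕ) + (j : ℕ) * (k : ℕ)) *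
        (4 * (ρ l * p l j k * deterministicOutcome f g l j k a b)) = 4 * (ρ l * p l j k) := by
    by_cases hp : p l j k = 0
    · simp [hp]
    have sign_eq_one : ∀ x y j k : Fin 2, x + y = j * k →
        (-1 : ℝ) ^ ((x : ℕ) + (y : ℕ) + (j : ℕ) * (k : ℕ)) = 1 := by
      intro x y j k h
      refine Even.neg_one_pow ?_
      revert x y j k
      decide
    calc
      _ = (-1 : ℝ) ^ ((f l j : ℕ) + (g l k : ℕ) + (j : ℕ) * (k : ℕ)) *
          (4 * (ρ l * p l j k)) := by simp [deterministicOutcome]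
      _ = _ := by rw [sign_eq_one _ _ _ _ (hwin l j k hp), one_mul]
  have total : ∑ a : Fin 2, ∑ b : Fin 2, ∑ j : Fin 2, ∑ k : Fin 2,
      (-1 : ℝ) ^ ((a : ℕ) + (b : ℕ) + (j : ℕ) * (k : ℕ)) *
        ptilde ρ p (deterministicOutcome f g) a b j k = 4 := by
    calc
      _ = ∑ l, ∑ j : Fin 2, ∑ k : Fin 2, ∑ a : Fin 2, ∑ b : Fin 2,
          (-1 : ℝ) ^ ((a : ℕ) + (b : ℕ) + (j : ℕ) * (k : ℕ)) *
            (4 * (ρ l * p l j k * deterministicOutcome f g l j k a b)) := by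
        simp only [ptilde, mul_sum, Fin.sum_univ_two, ← sum_add_distrib]
        exact sum_congr rfl fun l _ => by ring
      _ = 4 * ∑ l, ρ l * ∑ j, ∑ k, p l j k := by simp only [correlation, mul_sum]
      _ = 4 := by simp only [hp_sum, mul_one, hρ_sum]
  rw [chsh, total]
  norm_num

end Deterministic

/-- The uniform distribution on the three settings pairs other than `(u l, v l)`. -/
noncomputable def uniformExcept {Λ : Type} (u v : Λ → Fin 2) (l : Λ) (j k : Fin 2) : ℝ :=
  if j = u l ∧ k = v l then 0 else 1 / 3

lemma sum_uniformExcept {Λ : Type} (u v : Λ → Fin 2) (l : Λ) :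
    ∑ j, ∑ k, uniformExcept u v l j k = 1 := by
  unfold uniformExcept
  generalize u l = x
  generalize v l = y
  fin_cases x <;> fin_cases y <;> norm_num [Fin.sum_univ_two]

/-- for every `1/3 ≤ P ≤ 1` there is a finite no-signalling model
with uniform settings, free-will parameter at most `P`, deterministic outcomes
(all `q λ j k a b ∈ {0,1}`, hence `G = 1`), and CHSH value `S = 4`. -/
theorem exists_deterministic_model_chsh_four (P : ℝ) (hP : 1 / 3 ≤ P) (hP' : P ≤ 1) :
    ∃ (n : ℕ) (ρ : Fin n → ℝ) (p : Fin n → Fin 2 → Fin 2 → ℝ)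
      (q : Fin n → Fin 2 → Fin 2 → Fin 2 → Fin 2 → ℝ),
      IsModel ρ p q ∧ UniformSettings ρ p ∧ FreeWillLE ρ p P ∧
      (∀ l j k a b, q l j k a b = 0 ∨ q l j k a b = 1) ∧
      Gavg ρ q = 1 ∧ chsh ρ p q = 4 := by
  let u : Fin 4 → Fin 2 := ![0, 0, 1, 1]
  let v : Fin 4 → Fin 2 := ![0, 1, 0, 1]
  let f : Fin 4 → Fin 2 → Fin 2 := fun l j => j * (v l + 1)
  let g : Fin 4 → Fin 2 → Fin 2 := fun l k => k * (u l + 1) + (u l + 1) * (v l + 1)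
  have hρ_sum : ∑ _l : Fin 4, (1 / 4 : ℝ) = 1 := by norm_num
  have hwin : ∀ l j k, uniformExcept u v l j k ≠ 0 → f l j + g l k = j * k := by
    intro l j k h
    have hjk : ¬(j = u l ∧ k = v l) := fun hc => h (if_pos hc)
    clear h
    revert l j k
    decide
  refine ⟨4, fun _ => 1 / 4, uniformExcept u v, deterministicOutcome f g,
    isModel_deterministicOutcome f g (fun _ => by norm_num) hρ_sum (fun l j k => ?_)
      (sum_uniformExcept u v), fun j k => ?_, fun l _ j k => ?_,
    deterministicOutcome_eq_zero_or_one f g, (Gavg_deterministicOutcome f g _).trans hρ_sum,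
    chsh_deterministicOutcome_eq_four f g hρ_sum (sum_uniformExcept u v) hwin⟩
  · unfold uniformExcept
    split_ifs <;> norm_num
  · fin_cases j <;> fin_cases k <;> norm_num [uniformExcept, u, v, Fin.sum_univ_succ]
  · unfold uniformExcept
    split_ifs <;> linarith
end

section
/- For every G₀ with 1/2 ≤ G₀ ≤ 1 and every P with 1/4 ≤ P ≤ 1/3, there exists a finite no-signalling model with hidden-variable set Λ = Fin 4 satisfying the uniform-settings condition, with free-will parameter at most P, with average guessing probability exactly G₀, and with CHSH value exactly S = 4 − 8·(2G₀ − 1)·(1 − 3P). Hence the bound of Theorem 1 is tight. -/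
open Finset

/-- The first coordinate of the pair of settings that `l` disfavours. -/
def disfavouredA : Fin 4 → Fin 2 := ![0, 0, 1, 1]

/-- The second coordinate of the pair of settings that `l` disfavours. -/
def disfavouredB : Fin 4 → Fin 2 := ![0, 1, 0, 1]

/-- Settings distribution with weight `1 - 3P` on the disfavoured pair and `P` on the others. -/
noncomputable def settingsDist (P : ℝ) (l : Fin 4) (j k : Fin 2) : ℝ :=
  if j = disfavouredA l ∧ k = disfavouredB l then 1 - 3 * P else P

/-- Alice's answer in the deterministic strategy that fails only on the disfavoured pair. -/
def answerA (l : Fin 4) (j : Fin 2) : Fin 2 := j * (disfavouredB l + 1)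

/-- Bob's answer in the deterministic strategy that fails only on the disfavoured pair. -/
def answerB (l : Fin 4) (k : Fin 2) : Fin 2 := (disfavouredA l + 1) * (k + disfavouredB l + 1)

/-- Mixture of the deterministic strategy (weight `c`) and the Popescu–Rohrlich box
(weight `1 - c`). -/
noncomputable def mixedBox (c : ℝ) (l : Fin 4) (j k a b : Fin 2) : ℝ :=
  c * (if a = answerA l j ∧ b = answerB l k then 1 else 0) +
    (1 - c) * (if a + b = j * k then 1 / 2 else 0)

theorem mixedBox_nonneg {c : ℝ} (h0 : 0 ≤ c) (h1 : c ≤ 1) (l : Fin 4) (j k a b : Fin 2) :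
    0 ≤ mixedBox c l j k a b := by
  have h1' : 0 ≤ 1 - c := sub_nonneg.2 h1
  unfold mixedBox
  positivity

theorem sum_mixedBox_right (c : ℝ) (l : Fin 4) (j k a : Fin 2) :
    ∑ b, mixedBox c l j k a b = if a = answerA l j then (1 + c) / 2 else (1 - c) / 2 := by
  have hPR : ∑ b : Fin 2, (if a + b = j * k then (1 / 2 : ℝ) else 0) = 1 / 2 := by
    simp [← eq_sub_iff_add_eq']
  simp only [mixedBox, sum_add_distrib, ← mul_sum, hPR]
  by_cases h : a = answerA l j <;> simp [h] <;> ring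

theorem sum_mixedBox_left (c : ℝ) (l : Fin 4) (j k b : Fin 2) :
    ∑ a, mixedBox c l j k a b = if b = answerB l k then (1 + c) / 2 else (1 - c) / 2 := by
  have hPR : ∑ a : Fin 2, (if a + b = j * k then (1 / 2 : ℝ) else 0) = 1 / 2 := by
    simp [← eq_sub_iff_add_eq]
  simp only [mixedBox, sum_add_distrib, ← mul_sum, hPR]
  by_cases h : b = answerB l k <;> simp [h] <;> ring

theorem sum_sum_mixedBox (c : ℝ) (l : Fin 4) (j k : Fin 2) :
    ∑ a, ∑ b, mixedBox c l j k a b = 1 := by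
  simp only [sum_mixedBox_right]
  generalize answerA l j = x
  fin_cases x <;> simp <;> ring

theorem margA_mixedBox (c : ℝ) (l : Fin 4) (j a : Fin 2) :
    margA (mixedBox c) l j a = if a = answerA l j then (1 + c) / 2 else (1 - c) / 2 :=
  sum_mixedBox_right c l j 0 a

theorem margB_mixedBox (c : ℝ) (l : Fin 4) (k b : Fin 2) :
    margB (mixedBox c) l k b = if b = answerB l k then (1 + c) / 2 else (1 - c) / 2 :=
  sum_mixedBox_left c l 0 k b

theorem Gloc_mixedBox {c : ℝ} (h0 : 0 ≤ c) (l : Fin 4) :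
    Gloc (mixedBox c) l = (1 + c) / 2 := by
  have h : (1 - c) / 2 ≤ (1 + c) / 2 := by linarith
  have key (x : Fin 2) : max (if 0 = x then (1 + c) / 2 else (1 - c) / 2)
      (if 1 = x then (1 + c) / 2 else (1 - c) / 2) = (1 + c) / 2 := by
    fin_cases x <;> simp [h]
  simp only [Gloc, margA_mixedBox, margB_mixedBox, key, max_self]

theorem correlator_mixedBox (c : ℝ) (l : Fin 4) (j k : Fin 2) :
    ∑ a : Fin 2, ∑ b : Fin 2,
        (-1 : ℝ) ^ ((a : ℕ) + (b : ℕ) + (j : ℕ) * (k : ℕ)) * mixedBox c l j k a b =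
      if j = disfavouredA l ∧ k = disfavouredB l then 1 - 2 * c else 1 := by
  unfold mixedBox answerA answerB
  generalize disfavouredA l = u
  generalize disfavouredB l = v
  fin_cases u <;> fin_cases v <;> fin_cases j <;> fin_cases k <;>
    simp [Fin.sum_univ_two] <;> ring

theorem sum_settingsDist (P : ℝ) (l : Fin 4) : ∑ j, ∑ k, settingsDist P l j k = 1 := by
  unfold settingsDist
  generalize disfavouredA l = u
  generalize disfavouredB l = v
  fin_cases u <;> fin_cases v <;> simp [Fin.sum_univ_two] <;> ring

theorem uniformSettings_settingsDist (P : ℝ) :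
    UniformSettings (fun _ => 1 / 4) (settingsDist P) := by
  intro j k
  fin_cases j <;> fin_cases k <;>
    simp [Fin.sum_univ_four, settingsDist, disfavouredA, disfavouredB] <;> ring

theorem sum_settingsDist_mul_correlator (P c : ℝ) (l : Fin 4) :
    ∑ j, ∑ k, settingsDist P l j k *
        (if j = disfavouredA l ∧ k = disfavouredB l then 1 - 2 * c else 1) =
      1 - 2 * c * (1 - 3 * P) := by
  unfold settingsDist
  generalize disfavouredA l = u
  generalize disfavouredB l = v
  fin_cases u <;> fin_cases v <;> simp [Fin.sum_univ_two] <;> ring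

theorem chsh_eq_abs_sum_correlator {Λ : Type} [Fintype Λ] (ρ : Λ → ℝ)
    (p : Λ → Fin 2 → Fin 2 → ℝ) (q : Λ → Fin 2 → Fin 2 → Fin 2 → Fin 2 → ℝ) :
    chsh ρ p q = |4 * ∑ l, ρ l * ∑ j, ∑ k, p l j k * ∑ a : Fin 2, ∑ b : Fin 2,
      (-1 : ℝ) ^ ((a : ℕ) + (b : ℕ) + (j : ℕ) * (k : ℕ)) * q l j k a b| := by
  simp only [chsh, ptilde, Fin.sum_univ_two, mul_sum, ← sum_add_distrib]
  congr 1
  refine sum_congr rfl fun l _ => ?_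
  ring

theorem chsh_mixedBox (P c : ℝ) :
    chsh (fun _ => 1 / 4) (settingsDist P) (mixedBox c) = |4 - 8 * c * (1 - 3 * P)| := by
  simp only [chsh_eq_abs_sum_correlator, correlator_mixedBox, sum_settingsDist_mul_correlator]
  congr 1
  simp
  ring

/-- tightness of Theorem 1, general case: for every
`1/2 ≤ G₀ ≤ 1` and `1/4 ≤ P ≤ 1/3` there is a finite no-signalling model on
`Λ = Fin 4` with uniform settings, free-will parameter at most `P`, average
guessing probability exactly `G₀`, and CHSH value exactly `4 - 8(2G₀-1)(1-3P)`. -/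
theorem exists_model_attaining_bound (G₀ P : ℝ)
    (hG : 1 / 2 ≤ G₀) (hG' : G₀ ≤ 1) (hP : 1 / 4 ≤ P) (hP' : P ≤ 1 / 3) :
    ∃ (ρ : Fin 4 → ℝ) (p : Fin 4 → Fin 2 → Fin 2 → ℝ)
      (q : Fin 4 → Fin 2 → Fin 2 → Fin 2 → Fin 2 → ℝ),
      IsModel ρ p q ∧ UniformSettings ρ p ∧ FreeWillLE ρ p P ∧
      Gavg ρ q = G₀ ∧ chsh ρ p q = 4 - 8 * (2 * G₀ - 1) * (1 - 3 * P) := by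
  have h0 : 0 ≤ 2 * G₀ - 1 := by linarith
  have h1 : 2 * G₀ - 1 ≤ 1 := by linarith
  refine ⟨fun _ => 1 / 4, settingsDist P, mixedBox (2 * G₀ - 1),
    ⟨fun _ => by norm_num, by simp, fun l j k => ?_, sum_settingsDist P,
      mixedBox_nonneg h0 h1, sum_sum_mixedBox _, fun l j k a => ?_, fun l j k b => ?_⟩,
    uniformSettings_settingsDist P, fun l _ j k => ?_, ?_, ?_⟩
  · unfold settingsDist
    split_ifs <;> linarith
  · rw [sum_mixedBox_right, margA_mixedBox]
  · rw [sum_mixedBox_left, margB_mixedBox]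
  · unfold settingsDist
    split_ifs <;> linarith
  · simp [Gavg, Gloc_mixedBox h0]
  · rw [chsh_mixedBox, abs_of_nonneg]
    nlinarith [mul_nonneg (sub_nonneg.2 h1) (sub_nonneg.2 hP')]
end

section
/- For every finite no-signalling model satisfying the uniform-settings condition that is factorizable (i.e., p λ j k = pA λ j · pB λ k for some pA, pB : Λ → Fin 2 → ℝ with pA λ j, pB λ k ≥ 0 and Σ_j pA λ j = 1, Σ_k pB λ k = 1 for each λ), if the model has free-will parameter at most P with 1/4 ≤ P ≤ 1/2, then its CHSH value S and average guessing probability G satisfy S ≤ 4 − 4·(2G − 1)·(1 − 2P). -/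
open Finset

theorem setting_prob_lower_bound {x y P : ℝ} (h₁ : x * (1 - y) ≤ P) (h₂ : (1 - x) * y ≤ P)
    (h₃ : (1 - x) * (1 - y) ≤ P) : (1 - 2 * P) / 2 ≤ x * y := by
  rcases le_total (1 / 2) x with hx | hx
  · linarith
  · rcases le_total (1 / 2) y with hy | hy
    · linarith
    · nlinarith [mul_nonneg (sub_nonneg.2 hx) (sub_nonneg.2 hy)]

/-- The probabilities that the outcomes `a`, `b` violate `a + b = j * k` (mod 2), added up over the
four setting pairs, bound the bias of each marginal. -/
theorem two_mul_Gloc_sub_one_le_sum_losing {Λ : Type}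
    (q : Λ → Fin 2 → Fin 2 → Fin 2 → Fin 2 → ℝ) (l : Λ)
    (h0 : ∀ j k a b, 0 ≤ q l j k a b) (h1 : ∀ j k, ∑ a, ∑ b, q l j k a b = 1)
    (hA : ∀ j k a, ∑ b, q l j k a b = margA q l j a)
    (hB : ∀ j k b, ∑ a, q l j k a b = margB q l k b) :
    2 * Gloc q l - 1 ≤ (q l 0 0 0 1 + q l 0 0 1 0) + (q l 0 1 0 1 + q l 0 1 1 0)
      + (q l 1 0 0 1 + q l 1 0 1 0) + (q l 1 1 0 0 + q l 1 1 1 1) := by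
  have a1 := fun j a => hA j 1 a
  have b1 := fun k b => hB 1 k b
  simp only [margA, margB, Fin.sum_univ_two] at h1 a1 b1
  have hG : Gloc q l ≤ (1 + (q l 0 0 0 1 + q l 0 0 1 0 + (q l 0 1 0 1 + q l 0 1 1 0)
      + (q l 1 0 0 1 + q l 1 0 1 0) + (q l 1 1 0 0 + q l 1 1 1 1))) / 2 := by
    simp only [Gloc, margA, margB, Fin.sum_univ_two, max_le_iff]
    refine ⟨⟨⟨?_, ?_⟩, ?_, ?_⟩, ⟨?_, ?_⟩, ?_, ?_⟩ <;>
      linarith [h1 0 0, h1 0 1, h1 1 0, h1 1 1, a1 0 0, a1 0 1, a1 1 0, a1 1 1, b1 0 0, b1 0 1,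
        b1 1 0, b1 1 1, h0 0 0 0 0, h0 0 0 0 1, h0 0 0 1 0, h0 0 0 1 1, h0 0 1 0 0, h0 0 1 0 1,
        h0 0 1 1 0, h0 0 1 1 1, h0 1 0 0 0, h0 1 0 0 1, h0 1 0 1 0, h0 1 0 1 1, h0 1 1 0 0,
        h0 1 1 0 1, h0 1 1 1 0, h0 1 1 1 1]
  linarith

/-- The winning counterpart of `two_mul_Gloc_sub_one_le_sum_losing`. -/
theorem two_mul_Gloc_sub_one_le_sum_winning {Λ : Type}
    (q : Λ → Fin 2 → Fin 2 → Fin 2 → Fin 2 → ℝ) (l : Λ)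
    (h0 : ∀ j k a b, 0 ≤ q l j k a b) (h1 : ∀ j k, ∑ a, ∑ b, q l j k a b = 1)
    (hA : ∀ j k a, ∑ b, q l j k a b = margA q l j a)
    (hB : ∀ j k b, ∑ a, q l j k a b = margB q l k b) :
    2 * Gloc q l - 1 ≤ (q l 0 0 0 0 + q l 0 0 1 1) + (q l 0 1 0 0 + q l 0 1 1 1)
      + (q l 1 0 0 0 + q l 1 0 1 1) + (q l 1 1 0 1 + q l 1 1 1 0) := by
  have a1 := fun j a => hA j 1 a
  have b1 := fun k b => hB 1 k b
  simp only [margA, margB, Fin.sum_univ_two] at h1 a1 b1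
  have hG : Gloc q l ≤ (1 + (q l 0 0 0 0 + q l 0 0 1 1 + (q l 0 1 0 0 + q l 0 1 1 1)
      + (q l 1 0 0 0 + q l 1 0 1 1) + (q l 1 1 0 1 + q l 1 1 1 0))) / 2 := by
    simp only [Gloc, margA, margB, Fin.sum_univ_two, max_le_iff]
    refine ⟨⟨⟨?_, ?_⟩, ?_, ?_⟩, ⟨?_, ?_⟩, ?_, ?_⟩ <;>
      linarith [h1 0 0, h1 0 1, h1 1 0, h1 1 1, a1 0 0, a1 0 1, a1 1 0, a1 1 1, b1 0 0, b1 0 1,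
        b1 1 0, b1 1 1, h0 0 0 0 0, h0 0 0 0 1, h0 0 0 1 0, h0 0 0 1 1, h0 0 1 0 0, h0 0 1 0 1,
        h0 0 1 1 0, h0 0 1 1 1, h0 1 0 0 0, h0 1 0 0 1, h0 1 0 1 0, h0 1 0 1 1, h0 1 1 0 0,
        h0 1 1 0 1, h0 1 1 1 0, h0 1 1 1 1]
  linarith

/-- The contribution of a single hidden state to the CHSH expression. -/
noncomputable def chshLocal {Λ : Type} (p : Λ → Fin 2 → Fin 2 → ℝ)
    (q : Λ → Fin 2 → Fin 2 → Fin 2 → Fin 2 → ℝ) (l : Λ) : ℝ :=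
  ∑ a : Fin 2, ∑ b : Fin 2, ∑ j : Fin 2, ∑ k : Fin 2,
    (-1 : ℝ) ^ ((a : ℕ) + (b : ℕ) + (j : ℕ) * (k : ℕ)) * (4 * (p l j k * q l j k a b))

theorem chsh_eq_abs_sum_chshLocal {Λ : Type} [Fintype Λ] (ρ : Λ → ℝ)
    (p : Λ → Fin 2 → Fin 2 → ℝ) (q : Λ → Fin 2 → Fin 2 → Fin 2 → Fin 2 → ℝ) :
    chsh ρ p q = |∑ l, ρ l * chshLocal p q l| := by
  simp only [chsh, ptilde, chshLocal, Fin.sum_univ_two, mul_add, Finset.sum_add_distrib,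
    Finset.mul_sum]
  simp only [mul_assoc, mul_left_comm (ρ _)]

/-- If every setting pair has probability at least `c`, then a hidden state contributes at most
`4 - 8 * c * (2 * G - 1)` to the CHSH value. -/
theorem abs_chshLocal_le {Λ : Type} (p : Λ → Fin 2 → Fin 2 → ℝ)
    (q : Λ → Fin 2 → Fin 2 → Fin 2 → Fin 2 → ℝ) (l : Λ) {c : ℝ} (hc : 0 ≤ c)
    (hp : ∀ j k, c ≤ p l j k) (hp1 : ∑ j, ∑ k, p l j k = 1)
    (h0 : ∀ j k a b, 0 ≤ q l j k a b) (h1 : ∀ j k, ∑ a, ∑ b, q l j k a b = 1)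
    (hA : ∀ j k a, ∑ b, q l j k a b = margA q l j a)
    (hB : ∀ j k b, ∑ a, q l j k a b = margB q l k b) :
    |chshLocal p q l| ≤ 4 - 8 * c * (2 * Gloc q l - 1) := by
  have hl := mul_le_mul_of_nonneg_left (two_mul_Gloc_sub_one_le_sum_losing q l h0 h1 hA hB) hc
  have hw := mul_le_mul_of_nonneg_left (two_mul_Gloc_sub_one_le_sum_winning q l h0 h1 hA hB) hc
  have hpq : ∀ j k a b, c * q l j k a b ≤ p l j k * q l j k a b := fun j k a b =>
    mul_le_mul_of_nonneg_right (hp j k) (h0 j k a b)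
  have hpn : ∀ j k, p l j k * (q l j k 0 0 + q l j k 0 1 + (q l j k 1 0 + q l j k 1 1))
      = p l j k := fun j k => by
    have h := h1 j k
    simp only [Fin.sum_univ_two] at h
    rw [h, mul_one]
  simp only [Fin.sum_univ_two] at hp1
  have n00 := hpn 0 0
  have n01 := hpn 0 1
  have n10 := hpn 1 0
  have n11 := hpn 1 1
  simp only [chshLocal, Fin.sum_univ_two, Fin.val_zero, Fin.val_one, abs_le]
  norm_num
  constructor
  · linarith [hpq 0 0 0 0, hpq 0 0 1 1, hpq 0 1 0 0, hpq 0 1 1 1, hpq 1 0 0 0, hpq 1 0 1 1,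
      hpq 1 1 0 1, hpq 1 1 1 0]
  · linarith [hpq 0 0 0 1, hpq 0 0 1 0, hpq 0 1 0 1, hpq 0 1 1 0, hpq 1 0 0 1, hpq 1 0 1 0,
      hpq 1 1 0 0, hpq 1 1 1 1]

/-- factorizable case, upper bound: for every factorizable finite
no-signalling model with uniform settings and free-will parameter at most `P`,
`1/4 ≤ P ≤ 1/2`, the CHSH value satisfies `S ≤ 4 - 4(2G-1)(1-2P)`. -/
theorem chsh_le_of_freeWill_factorizable {Λ : Type} [Fintype Λ] (ρ : Λ → ℝ)
    (p : Λ → Fin 2 → Fin 2 → ℝ) (q : Λ → Fin 2 → Fin 2 → Fin 2 → Fin 2 → ℝ)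
    (pA pB : Λ → Fin 2 → ℝ) (P : ℝ)
    (hmodel : IsModel ρ p q) (hunif : UniformSettings ρ p)
    (hfac : ∀ l j k, p l j k = pA l j * pB l k)
    (hpA0 : ∀ l j, 0 ≤ pA l j) (hpA1 : ∀ l, ∑ j, pA l j = 1)
    (hpB0 : ∀ l k, 0 ≤ pB l k) (hpB1 : ∀ l, ∑ k, pB l k = 1)
    (hfw : FreeWillLE ρ p P) (hP : 1 / 4 ≤ P) (hP' : P ≤ 1 / 2) :
    chsh ρ p q ≤ 4 - 4 * (2 * Gavg ρ q - 1) * (1 - 2 * P) := by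
  obtain ⟨hρ0, hρ1, -, hp1, hq0, hq1, hqA, hqB⟩ := hmodel
  have hlower : ∀ l, 0 < ρ l → ∀ j k, (1 - 2 * P) / 2 ≤ p l j k := by
    intro l hl
    have hf := hfw l hl
    have hA := hpA1 l
    have hB := hpB1 l
    simp only [Fin.sum_univ_two] at hA hB
    have hA' : ∀ j, pA l (1 - j) = 1 - pA l j := by
      intro j; fin_cases j <;> simp <;> linarith
    have hB' : ∀ k, pB l (1 - k) = 1 - pB l k := by
      intro k; fin_cases k <;> simp <;> linarith
    intro j k
    have h01 := hf j (1 - k)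
    have h10 := hf (1 - j) k
    have h11 := hf (1 - j) (1 - k)
    rw [hfac] at h01 h10 h11 ⊢
    rw [hB'] at h01 h11
    rw [hA'] at h10 h11
    exact setting_prob_lower_bound h01 h10 h11
  rw [chsh_eq_abs_sum_chshLocal]
  calc |∑ l, ρ l * chshLocal p q l|
      ≤ ∑ l, |ρ l * chshLocal p q l| := Finset.abs_sum_le_sum_abs _ _
    _ ≤ ∑ l, ρ l * (4 - 8 * ((1 - 2 * P) / 2) * (2 * Gloc q l - 1)) := by
        refine Finset.sum_le_sum fun l _ => ?_
        rw [abs_mul, abs_of_nonneg (hρ0 l)]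
        rcases (hρ0 l).eq_or_lt with h | h
        · simp [← h]
        · exact mul_le_mul_of_nonneg_left (abs_chshLocal_le p q l (by linarith) (hlower l h)
            (hp1 l) (hq0 l) (hq1 l) (hqA l) (hqB l)) h.le
    _ = ∑ l, ((4 + 4 * (1 - 2 * P)) * ρ l - 8 * (1 - 2 * P) * (ρ l * Gloc q l)) :=
        Finset.sum_congr rfl fun l _ => by ring
    _ = 4 - 4 * (2 * Gavg ρ q - 1) * (1 - 2 * P) := by
        rw [Finset.sum_sub_distrib, ← Finset.mul_sum, ← Finset.mul_sum, hρ1, Gavg]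
        ring
end

section
/- For every G₀ with 1/2 ≤ G₀ ≤ 1 and every P with 1/4 ≤ P ≤ 1/2, there exists a finite no-signalling model with hidden-variable set Λ = Fin 4 that is factorizable (p λ j k = pA λ j · pB λ k with pA λ, pB λ probability vectors on Fin 2), satisfies the uniform-settings condition, has free-will parameter at most P, has average guessing probability exactly G₀, and has CHSH value exactly S = 4 − 4·(2G₀ − 1)·(1 − 2P). Hence the factorizable bound is tight. -/
open Finset

/-- Alice's deterministic response in the `l`-th local strategy. The four strategies, indexed by
pairs of settings, each satisfy the CHSH condition `a + b = j * k` at all but their own pair. -/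
def strategyA : Fin 4 → Fin 2 → Fin 2 := ![![1, 0], ![0, 0], ![0, 1], ![0, 0]]

/-- Bob's deterministic response in the `l`-th local strategy. -/
def strategyB : Fin 4 → Fin 2 → Fin 2 := ![![0, 1], ![0, 1], ![0, 0], ![0, 0]]

/-- The mixture of a PR box with weight `2 - 2 * G` and the deterministic responses
`f`, `g` with weight `2 * G - 1`. -/
noncomputable def noisyStrategy (G : ℝ) (f g : Fin 2 → Fin 2) (j k a b : Fin 2) : ℝ :=
  (1 - G) * (if a + b = j * k then 1 else 0) +
    (2 * G - 1) * (if a = f j ∧ b = g k then 1 else 0)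

/-- Bob's setting distribution, disfavouring the setting at which the `l`-th strategy fails. -/
noncomputable def biasedSetting (P : ℝ) (l : Fin 4) (k : Fin 2) : ℝ :=
  if k = ![0, 1, 0, 1] l then 1 - 2 * P else 2 * P

lemma noisyStrategy_nonneg {G : ℝ} (hG : 1 / 2 ≤ G) (hG' : G ≤ 1) (f g : Fin 2 → Fin 2)
    (j k a b : Fin 2) : 0 ≤ noisyStrategy G f g j k a b := by
  unfold noisyStrategy
  split_ifs <;> linarith

lemma sum_noisyStrategy_right (G : ℝ) (f g : Fin 2 → Fin 2) (j k a : Fin 2) :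
    ∑ b, noisyStrategy G f g j k a b = (1 - G) + (2 * G - 1) * (if a = f j then 1 else 0) := by
  simp only [noisyStrategy, sum_add_distrib, ← mul_sum, ite_and, ← eq_sub_iff_add_eq']
  by_cases h : a = f j <;> simp [h]

lemma sum_noisyStrategy_left (G : ℝ) (f g : Fin 2 → Fin 2) (j k b : Fin 2) :
    ∑ a, noisyStrategy G f g j k a b = (1 - G) + (2 * G - 1) * (if b = g k then 1 else 0) := by
  simp only [noisyStrategy, sum_add_distrib, ← mul_sum, and_comm (b := b = g k), ite_and,
    ← eq_sub_iff_add_eq]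
  by_cases h : b = g k <;> simp [h]

lemma Gloc_noisyStrategy {G : ℝ} (hG : 1 / 2 ≤ G) (f g : Fin 4 → Fin 2 → Fin 2) (l : Fin 4) :
    Gloc (fun l => noisyStrategy G (f l) (g l)) l = G := by
  have key : ∀ x : Fin 2, max ((1 - G) + (2 * G - 1) * (if 0 = x then 1 else 0))
      ((1 - G) + (2 * G - 1) * (if 1 = x then 1 else 0)) = G := by
    intro x
    fin_cases x
    · simpa using (max_eq_left (by linarith) : max (1 - G + (2 * G - 1)) (1 - G) = _).trans
        (by ring)
    · simpa using (max_eq_right (by linarith) : max (1 - G) (1 - G + (2 * G - 1)) = _).trans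
        (by ring)
  simp only [Gloc, margA, margB, sum_noisyStrategy_right, sum_noisyStrategy_left, key, max_self]

lemma chsh_noisyStrategy {G P : ℝ} (hG : 1 / 2 ≤ G) (hG' : G ≤ 1) (hP : 1 / 4 ≤ P) :
    chsh (fun _ : Fin 4 => 1 / 4) (fun l _ k => 1 / 2 * biasedSetting P l k)
      (fun l => noisyStrategy G (strategyA l) (strategyB l)) =
        4 - 4 * (2 * G - 1) * (1 - 2 * P) := by
  have hpos : 0 ≤ 4 - 4 * (2 * G - 1) * (1 - 2 * P) := by
    nlinarith [mul_nonneg (sub_nonneg.2 hG) (sub_nonneg.2 hP)]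
  rw [chsh, ← abs_of_nonneg hpos]
  congr 1
  simp [ptilde, Fin.sum_univ_four, Fin.sum_univ_two, noisyStrategy, biasedSetting, strategyA,
    strategyB]
  ring

/-- tightness of the factorizable bound: for every `1/2 ≤ G₀ ≤ 1`
and `1/4 ≤ P ≤ 1/2` there is a factorizable finite no-signalling model on
`Λ = Fin 4` with uniform settings, free-will parameter at most `P`, average
guessing probability exactly `G₀`, and CHSH value exactly `4 - 4(2G₀-1)(1-2P)`. -/
theorem exists_factorizable_model_attaining_bound (G₀ P : ℝ)
    (hG : 1 / 2 ≤ G₀) (hG' : G₀ ≤ 1) (hP : 1 / 4 ≤ P) (hP' : P ≤ 1 / 2) :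
    ∃ (ρ : Fin 4 → ℝ) (p : Fin 4 → Fin 2 → Fin 2 → ℝ)
      (q : Fin 4 → Fin 2 → Fin 2 → Fin 2 → Fin 2 → ℝ) (pA pB : Fin 4 → Fin 2 → ℝ),
      IsModel ρ p q ∧ UniformSettings ρ p ∧ FreeWillLE ρ p P ∧
      (∀ l j k, p l j k = pA l j * pB l k) ∧
      (∀ l j, 0 ≤ pA l j) ∧ (∀ l, ∑ j, pA l j = 1) ∧
      (∀ l k, 0 ≤ pB l k) ∧ (∀ l, ∑ k, pB l k = 1) ∧
      Gavg ρ q = G₀ ∧ chsh ρ p q = 4 - 4 * (2 * G₀ - 1) * (1 - 2 * P) := by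
  have hsum : ∀ l, ∑ k, biasedSetting P l k = 1 := by
    intro l
    fin_cases l <;> simp [biasedSetting]
  have hnonneg : ∀ l k, 0 ≤ biasedSetting P l k := by
    intro l k
    unfold biasedSetting
    split_ifs <;> linarith
  have hle : ∀ l k, biasedSetting P l k ≤ 2 * P := by
    intro l k
    unfold biasedSetting
    split_ifs <;> linarith
  refine ⟨fun _ => 1 / 4, fun l _ k => 1 / 2 * biasedSetting P l k,
    fun l => noisyStrategy G₀ (strategyA l) (strategyB l), fun _ _ => 1 / 2, biasedSetting P,
    ⟨fun _ => by norm_num, by norm_num, fun l _ k => mul_nonneg (by norm_num) (hnonneg l k),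
      fun l => by simp [← mul_sum, hsum l],
      fun l => noisyStrategy_nonneg hG hG' _ _, fun l j k => ?_,
      fun l j k a => by simp only [margA, sum_noisyStrategy_right],
      fun l j k b => by simp only [margB, sum_noisyStrategy_left]⟩,
    fun _ k => ?_, fun l _ _ k => by linarith [hle l k], fun _ _ _ => rfl,
    fun _ _ => by norm_num, fun _ => by norm_num, hnonneg, hsum, ?_,
    chsh_noisyStrategy hG hG' hP⟩
  · simp only [sum_noisyStrategy_right, sum_add_distrib, ← mul_sum]
    simp
    ring
  · fin_cases k <;> simp [Fin.sum_univ_four, biasedSetting] <;> ring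
  · simp [Gavg, Gloc_noisyStrategy hG]
end

section
/- For every real P with 1/2 ≤ P ≤ 1 there exists a finite no-signalling model that is factorizable (p λ j k = pA λ j · pB λ k with pA λ, pB λ probability vectors on Fin 2), satisfies the uniform-settings condition, has free-will parameter at most P, has all outcome probabilities q λ j k a b equal to 0 or 1 (hence average guessing probability G = 1), and has CHSH value S = 4. -/
open Finset

/-- for every `1/2 ≤ P ≤ 1` there is a factorizable finite
no-signalling model with uniform settings, free-will parameter at most `P`,
deterministic outcomes (all `q λ j k a b ∈ {0,1}`, hence `G = 1`), and
CHSH value `S = 4`. -/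
theorem exists_factorizable_deterministic_model_chsh_four (P : ℝ)
    (hP : 1 / 2 ≤ P) (hP' : P ≤ 1) :
    ∃ (n : ℕ) (ρ : Fin n → ℝ) (p : Fin n → Fin 2 → Fin 2 → ℝ)
      (q : Fin n → Fin 2 → Fin 2 → Fin 2 → Fin 2 → ℝ) (pA pB : Fin n → Fin 2 → ℝ),
      IsModel ρ p q ∧ UniformSettings ρ p ∧ FreeWillLE ρ p P ∧
      (∀ l j k, p l j k = pA l j * pB l k) ∧
      (∀ l j, 0 ≤ pA l j) ∧ (∀ l, ∑ j, pA l j = 1) ∧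
      (∀ l k, 0 ≤ pB l k) ∧ (∀ l, ∑ k, pB l k = 1) ∧
      (∀ l j k a b, q l j k a b = 0 ∨ q l j k a b = 1) ∧
      Gavg ρ q = 1 ∧ chsh ρ p q = 4 := by
  refine ⟨2, fun _ => 1 / 2, fun l j _ => (if j = l then 1 else 0) * (1 / 2),
    fun l _ k a b => if a = 0 ∧ b = l * k then 1 else 0,
    fun l j => if j = l then 1 else 0, fun _ _ => 1 / 2,
    ⟨?_, ?_, ?_, ?_, ?_, ?_, ?_, ?_⟩, ?_, ?_, ?_, ?_, ?_, ?_, ?_, ?_, ?_, ?_⟩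
  · intro l; norm_num
  · norm_num
  · intro l j k; positivity
  · intro l; fin_cases l <;> norm_num
  · intro l j k a b; positivity
  · intro l j k; fin_cases l <;> fin_cases k <;> simp [Fin.sum_univ_two, -Finset.sum_boole]
  · intro l j k a; fin_cases l <;> fin_cases k <;> fin_cases a <;> simp [margA]
  · intro l j k b; simp [margB]
  · intro j k; fin_cases j <;> norm_num
  · intro l _ j k
    dsimp only
    split_ifs <;> linarith
  · intro l j k; rfl
  · intro l j; positivity
  · intro l; simp
  · intro l k; norm_num
  · intro l; norm_num
  · intro l j k a b
    dsimp only
    split_ifs <;> simp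
  · simp [Gavg, Gloc, margA, margB, Fin.sum_univ_two, -Finset.sum_boole]; norm_num
  · norm_num [chsh, ptilde, Fin.sum_univ_two]
end

section
/- For every finite no-signalling model satisfying the uniform-settings condition with free-will parameter at most P where 1/4 ≤ P < 1/3, the average guessing probability G is bounded in terms of the CHSH value S by G ≤ (1/2)·(1 + (4 − S)/(8·(1 − 3P))). -/
open Finset

/-- The sign `(-1)^(a+b+jk)` of the CHSH expression. -/
noncomputable def chshSign (j k a b : Fin 2) : ℝ :=
  (-1 : ℝ) ^ ((a : ℕ) + (b : ℕ) + (j : ℕ) * (k : ℕ))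

/-- Probability-weighted deficit of the outcomes at settings `j, k` from perfect
(anti)correlation, where `s = ±1` is the orientation of the CHSH expression. -/
noncomputable def chshDeficit {Λ : Type} (q : Λ → Fin 2 → Fin 2 → Fin 2 → Fin 2 → ℝ)
    (s : ℝ) (l : Λ) (j k : Fin 2) : ℝ := ∑ a, ∑ b, (1 - s * chshSign j k a b) * q l j k a b

lemma chshDeficit_nonneg {Λ : Type} {q : Λ → Fin 2 → Fin 2 → Fin 2 → Fin 2 → ℝ}
    (hq : ∀ l j k a b, 0 ≤ q l j k a b) {s : ℝ} (hs : |s| ≤ 1) (l : Λ) (j k : Fin 2) :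
    0 ≤ chshDeficit q s l j k := by
  refine sum_nonneg fun a _ => sum_nonneg fun b _ => mul_nonneg ?_ (hq l j k a b)
  have h : |s * chshSign j k a b| ≤ 1 := by simpa [chshSign, abs_mul] using hs
  linarith [(abs_le.mp h).2]

/-- Monogamy between nonlocality and local predictability: `2 (2 G(λ) - 1) ≤ 4 - S(λ)`. -/
lemma two_mul_Gloc_sub_one_le {Λ : Type} [Fintype Λ] {ρ : Λ → ℝ} {p : Λ → Fin 2 → Fin 2 → ℝ}
    {q : Λ → Fin 2 → Fin 2 → Fin 2 → Fin 2 → ℝ} (hmodel : IsModel ρ p q)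
    {s : ℝ} (hs : s = 1 ∨ s = -1) (l : Λ) :
    2 * (2 * Gloc q l - 1) ≤ ∑ j, ∑ k, chshDeficit q s l j k := by
  obtain ⟨-, -, -, -, hq, hsum, hA, hB⟩ := hmodel
  suffices h : Gloc q l ≤ 1 / 2 + (∑ j, ∑ k, chshDeficit q s l j k) / 4 by linarith
  have nonneg := hq l
  have total := hsum l
  have alice := fun j a => hA l j 1 a
  have bob := fun k b => hB l 1 k b
  simp only [Fin.forall_fin_two, margA, margB, Fin.sum_univ_two] at nonneg total alice bob
  rcases hs with rfl | rfl <;>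
  · simp only [Gloc, max_le_iff, margA, margB, chshDeficit, chshSign, Fin.sum_univ_two]
    norm_num
    refine ⟨⟨⟨?_, ?_⟩, ?_, ?_⟩, ⟨?_, ?_⟩, ?_, ?_⟩ <;> linarith

/-- If all four settings have probability at most `P`, each has probability at least `1 - 3P`. -/
lemma one_sub_three_mul_le {w : Fin 2 → Fin 2 → ℝ} {P : ℝ} (hw : ∑ j, ∑ k, w j k = 1)
    (hP : ∀ j k, w j k ≤ P) (j k : Fin 2) : 1 - 3 * P ≤ w j k := by
  simp only [Fin.sum_univ_two, Fin.forall_fin_two] at hw hP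
  revert j k
  simp only [Fin.forall_fin_two]
  refine ⟨⟨?_, ?_⟩, ?_, ?_⟩ <;> linarith

lemma four_sub_chsh_expr_eq {Λ : Type} [Fintype Λ] {ρ : Λ → ℝ} {p : Λ → Fin 2 → Fin 2 → ℝ}
    {q : Λ → Fin 2 → Fin 2 → Fin 2 → Fin 2 → ℝ} (hmodel : IsModel ρ p q) (s : ℝ) :
    4 - s * ∑ a : Fin 2, ∑ b : Fin 2, ∑ j : Fin 2, ∑ k : Fin 2,
        chshSign j k a b * ptilde ρ p q a b j k =
      4 * ∑ l, ρ l * ∑ j, ∑ k, p l j k * chshDeficit q s l j k := by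
  obtain ⟨-, hρ, -, hp, -, hsum, -, -⟩ := hmodel
  have h : ∀ l, ∑ j, ∑ k, p l j k * chshDeficit q s l j k =
      1 - s * ∑ a, ∑ b, ∑ j, ∑ k, chshSign j k a b * (p l j k * q l j k a b) := by
    intro l
    have total := hsum l
    have settings := hp l
    simp only [Fin.forall_fin_two, Fin.sum_univ_two] at total settings
    simp only [chshDeficit, Fin.sum_univ_two]
    linear_combination settings + p l 0 0 * total.1.1 + p l 0 1 * total.1.2 +
      p l 1 0 * total.2.1 + p l 1 1 * total.2.2
  simp only [h, mul_sub, mul_one, sum_sub_distrib, hρ, ptilde]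
  simp only [Fin.sum_univ_two, mul_add, sum_add_distrib, mul_sum]
  simp only [mul_assoc, mul_left_comm]

lemma eight_mul_Gavg_le {Λ : Type} [Fintype Λ] {ρ : Λ → ℝ} {p : Λ → Fin 2 → Fin 2 → ℝ}
    {q : Λ → Fin 2 → Fin 2 → Fin 2 → Fin 2 → ℝ} {P : ℝ} (hmodel : IsModel ρ p q)
    (hfw : FreeWillLE ρ p P) (hP : P ≤ 1 / 3) {s : ℝ} (hs : s = 1 ∨ s = -1) :
    8 * (1 - 3 * P) * (2 * Gavg ρ q - 1) ≤
      4 - s * ∑ a : Fin 2, ∑ b : Fin 2, ∑ j : Fin 2, ∑ k : Fin 2,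
        chshSign j k a b * ptilde ρ p q a b j k := by
  rw [four_sub_chsh_expr_eq hmodel]
  have hG : 8 * (1 - 3 * P) * (2 * Gavg ρ q - 1) =
      4 * ∑ l, ρ l * ((1 - 3 * P) * (2 * (2 * Gloc q l - 1))) := by
    have h : ∑ l, ρ l * ((1 - 3 * P) * (2 * (2 * Gloc q l - 1))) =
        4 * (1 - 3 * P) * Gavg ρ q - 2 * (1 - 3 * P) * ∑ l, ρ l := by
      rw [Gavg, mul_sum, mul_sum, ← sum_sub_distrib]
      exact sum_congr rfl fun l _ => by ring
    rw [h, hmodel.2.1]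
    ring
  rw [hG]
  refine mul_le_mul_of_nonneg_left (sum_le_sum fun l _ => ?_) (by norm_num)
  rcases (hmodel.1 l).eq_or_lt with h0 | hpos
  · simp [← h0]
  refine mul_le_mul_of_nonneg_left ?_ hpos.le
  refine (mul_le_mul_of_nonneg_left (two_mul_Gloc_sub_one_le hmodel hs l)
    (by linarith)).trans ?_
  simp only [mul_sum]
  refine sum_le_sum fun j _ => sum_le_sum fun k _ => mul_le_mul_of_nonneg_right
    (one_sub_three_mul_le (hmodel.2.2.2.1 l) (hfw l hpos) j k)
    (chshDeficit_nonneg hmodel.2.2.2.2.1 ?_ l j k)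
  rcases hs with rfl | rfl <;> simp

/-- for every finite no-signalling model with uniform settings and
free-will parameter at most `P`, `1/4 ≤ P < 1/3`, the average guessing probability
is bounded by `G ≤ (1/2)(1 + (4-S)/(8(1-3P)))`. -/
theorem guessing_le_of_chsh {Λ : Type} [Fintype Λ] (ρ : Λ → ℝ)
    (p : Λ → Fin 2 → Fin 2 → ℝ) (q : Λ → Fin 2 → Fin 2 → Fin 2 → Fin 2 → ℝ)
    (P : ℝ) (hmodel : IsModel ρ p q) (hunif : UniformSettings ρ p)
    (hfw : FreeWillLE ρ p P) (hP : 1 / 4 ≤ P) (hP' : P < 1 / 3) :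
    Gavg ρ q ≤ (1 / 2) * (1 + (4 - chsh ρ p q) / (8 * (1 - 3 * P))) := by
  have hS : 8 * (1 - 3 * P) * (2 * Gavg ρ q - 1) ≤ 4 - chsh ρ p q := by
    have hplus := eight_mul_Gavg_le hmodel hfw hP'.le (Or.inl rfl)
    have hminus := eight_mul_Gavg_le hmodel hfw hP'.le (Or.inr rfl)
    rw [le_sub_comm]
    exact abs_le'.mpr ⟨by simp only [chshSign] at hplus; linarith,
      by simp only [chshSign] at hminus; linarith⟩
  have hm : 0 < 8 * (1 - 3 * P) := by linarith
  have h : 2 * Gavg ρ q - 1 ≤ (4 - chsh ρ p q) / (8 * (1 - 3 * P)) := by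
    rw [le_div_iff₀ hm]
    linarith
  linarith
end

section
/- Let m₀, m₁, n₀, n₁ ∈ [0,1] and let g := max{m₀, m₁, n₀, n₁, 1−m₀, 1−m₁, 1−n₀, 1−n₁}. Then |m₀ − n₀| + |m₀ − n₁| + |m₁ − n₀| + |m₁ + n₁ − 1| ≥ 2g − 1. (In particular the left-hand side is bounded below both by |n₀ − n₁| + |n₀ + n₁ − 1| and by |m₀ − m₁| + |m₀ + m₁ − 1|.) -/
/-- key combinatorial lemma of Theorem 1: for marginal
probabilities `m₀, m₁, n₀, n₁ ∈ [0,1]` and local guessing probability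
`g = max{m₀, m₁, n₀, n₁, 1-m₀, 1-m₁, 1-n₀, 1-n₁}`, the quantity
`K = |m₀-n₀| + |m₀-n₁| + |m₁-n₀| + |m₁+n₁-1|` satisfies `K ≥ 2g - 1`, and in
particular `K ≥ |n₀-n₁| + |n₀+n₁-1|` and `K ≥ |m₀-m₁| + |m₀+m₁-1|`. -/
theorem abs_sum_ge_two_guess_sub_one (m₀ m₁ n₀ n₁ g : ℝ)
    (hm₀ : 0 ≤ m₀) (hm₀' : m₀ ≤ 1) (hm₁ : 0 ≤ m₁) (hm₁' : m₁ ≤ 1)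
    (hn₀ : 0 ≤ n₀) (hn₀' : n₀ ≤ 1) (hn₁ : 0 ≤ n₁) (hn₁' : n₁ ≤ 1)
    (hg : g = max (max (max m₀ m₁) (max n₀ n₁))
        (max (max (1 - m₀) (1 - m₁)) (max (1 - n₀) (1 - n₁)))) :
    |m₀ - n₀| + |m₀ - n₁| + |m₁ - n₀| + |m₁ + n₁ - 1| ≥ 2 * g - 1 ∧
    |m₀ - n₀| + |m₀ - n₁| + |m₁ - n₀| + |m₁ + n₁ - 1| ≥ |n₀ - n₁| + |n₀ + n₁ - 1| ∧
    |m₀ - n₀| + |m₀ - n₁| + |m₁ - n₀| + |m₁ + n₁ - 1| ≥ |m₀ - m₁| + |m₀ + m₁ - 1| := by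
  have hn : |n₀ - n₁| + |n₀ + n₁ - 1| ≤
      |m₀ - n₀| + |m₀ - n₁| + |m₁ - n₀| + |m₁ + n₁ - 1| := by
    have h₁ := abs_sub_le n₀ m₀ n₁
    have h₂ := abs_sub_le n₀ m₁ (1 - n₁)
    rw [abs_sub_comm n₀ m₀] at h₁
    rw [abs_sub_comm n₀ m₁, ← sub_add, ← sub_add, sub_add_eq_add_sub, sub_add_eq_add_sub] at h₂
    linarith
  have hm : |m₀ - m₁| + |m₀ + m₁ - 1| ≤
      |m₀ - n₀| + |m₀ - n₁| + |m₁ - n₀| + |m₁ + n₁ - 1| := by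
    have h₁ := abs_sub_le m₀ n₀ m₁
    have h₂ := abs_add_le (m₀ - n₁) (m₁ + n₁ - 1)
    rw [abs_sub_comm n₀ m₁] at h₁
    rw [show m₀ - n₁ + (m₁ + n₁ - 1) = m₀ + m₁ - 1 by ring] at h₂
    linarith
  refine ⟨?_, hn, hm⟩
  suffices g ≤ (|m₀ - n₀| + |m₀ - n₁| + |m₁ - n₀| + |m₁ + n₁ - 1| + 1) / 2 by linarith
  have hd := abs_le.mp (le_refl |n₀ - n₁|)
  have hs := abs_le.mp (le_refl |n₀ + n₁ - 1|)
  have hd' := abs_le.mp (le_refl |m₀ - m₁|)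
  have hs' := abs_le.mp (le_refl |m₀ + m₁ - 1|)
  simp only [hg, max_le_iff]
  refine ⟨⟨⟨?_, ?_⟩, ?_, ?_⟩, ⟨?_, ?_⟩, ?_, ?_⟩ <;> linarith
end

section
/- Let p₀₀, p₀₁, p₁₀, p₁₁ > 0 and let α be a real number such that p₀₀² + p₀₁² + p₀₀p₀₁α ≥ 0 and p₁₀² + p₁₁² − p₁₀p₁₁α ≥ 0. Then √(p₀₀² + p₀₁² + p₀₀p₀₁α) + √(p₁₀² + p₁₁² − p₁₀p₁₁α) ≤ √(p₀₀p₀₁ + p₁₀p₁₁) · √((p₀₀² + p₀₁²)/(p₀₀p₀₁) + (p₁₀² + p₁₁²)/(p₁₀p₁₁)), with equality when α = [p₀₀²p₀₁²(p₁₀² + p₁₁²) − p₁₀²p₁₁²(p₀₀² + p₀₁²)] / [p₀₀p₀₁p₁₀p₁₁(p₀₀p₀₁ + p₁₀p₁₁)]. -/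
theorem Real.sqrt_add_sqrt_le_sqrt_mul_sqrt_div_add_div {a b x y : ℝ} (ha : 0 < a) (hb : 0 < b)
    (hx : 0 ≤ x) (hy : 0 ≤ y) :
    Real.sqrt x + Real.sqrt y ≤ Real.sqrt (a + b) * Real.sqrt (x / a + y / b) := by
  rw [← Real.sqrt_mul (by positivity)]
  refine Real.le_sqrt_of_sq_le ?_
  have key : (a + b) * (x / a + y / b) - (Real.sqrt x + Real.sqrt y) ^ 2 =
      (b * Real.sqrt x - a * Real.sqrt y) ^ 2 / (a * b) := by
    nth_rewrite 1 [← Real.sq_sqrt hx, ← Real.sq_sqrt hy]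
    field_simp
    ring
  have : 0 ≤ (b * Real.sqrt x - a * Real.sqrt y) ^ 2 / (a * b) := by positivity
  linarith

theorem Real.sqrt_add_sqrt_eq_sqrt_mul_sqrt_div_add_div {a b x y : ℝ} (ha : 0 < a) (hb : 0 < b)
    (hx : 0 ≤ x) (h : b ^ 2 * x = a ^ 2 * y) :
    Real.sqrt x + Real.sqrt y = Real.sqrt (a + b) * Real.sqrt (x / a + y / b) := by
  obtain ⟨s, hs, rfl⟩ : ∃ s, 0 ≤ s ∧ x = a ^ 2 * s := ⟨x / a ^ 2, by positivity, by field_simp⟩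
  obtain rfl : y = b ^ 2 * s := by
    apply mul_left_cancel₀ (pow_ne_zero 2 ha.ne')
    linarith
  have hab : a ^ 2 * s / a + b ^ 2 * s / b = (a + b) * s := by
    field_simp
  rw [hab, Real.sqrt_mul (by positivity), Real.sqrt_mul (by positivity), Real.sqrt_sq ha.le,
    Real.sqrt_sq hb.le, Real.sqrt_mul (by positivity), ← mul_assoc,
    Real.mul_self_sqrt (by positivity), add_mul]

/-- optimization over the anticommutator parameter `α`: for
positive `p_{jk}` and real `α` with both radicands nonnegative,
`√(p₀₀² + p₀₁² + p₀₀p₀₁α) + √(p₁₀² + p₁₁² - p₁₀p₁₁α)` is bounded by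
`√(p₀₀p₀₁ + p₁₀p₁₁) · √((p₀₀² + p₀₁²)/(p₀₀p₀₁) + (p₁₀² + p₁₁²)/(p₁₀p₁₁))`,
with equality at the optimal value of `α`. -/
theorem sqrt_add_sqrt_le_tsirelson (p₀₀ p₀₁ p₁₀ p₁₁ α : ℝ)
    (h₀₀ : 0 < p₀₀) (h₀₁ : 0 < p₀₁) (h₁₀ : 0 < p₁₀) (h₁₁ : 0 < p₁₁)
    (hr₁ : 0 ≤ p₀₀ ^ 2 + p₀₁ ^ 2 + p₀₀ * p₀₁ * α)
    (hr₂ : 0 ≤ p₁₀ ^ 2 + p₁₁ ^ 2 - p₁₀ * p₁₁ * α) :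
    Real.sqrt (p₀₀ ^ 2 + p₀₁ ^ 2 + p₀₀ * p₀₁ * α) +
        Real.sqrt (p₁₀ ^ 2 + p₁₁ ^ 2 - p₁₀ * p₁₁ * α) ≤
      Real.sqrt (p₀₀ * p₀₁ + p₁₀ * p₁₁) *
        Real.sqrt ((p₀₀ ^ 2 + p₀₁ ^ 2) / (p₀₀ * p₀₁) + (p₁₀ ^ 2 + p₁₁ ^ 2) / (p₁₀ * p₁₁)) ∧
    (α = (p₀₀ ^ 2 * p₀₁ ^ 2 * (p₁₀ ^ 2 + p₁₁ ^ 2) - p₁₀ ^ 2 * p₁₁ ^ 2 * (p₀₀ ^ 2 + p₀₁ ^ 2)) /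
        (p₀₀ * p₀₁ * p₁₀ * p₁₁ * (p₀₀ * p₀₁ + p₁₀ * p₁₁)) →
      Real.sqrt (p₀₀ ^ 2 + p₀₁ ^ 2 + p₀₀ * p₀₁ * α) +
          Real.sqrt (p₁₀ ^ 2 + p₁₁ ^ 2 - p₁₀ * p₁₁ * α) =
        Real.sqrt (p₀₀ * p₀₁ + p₁₀ * p₁₁) *
          Real.sqrt ((p₀₀ ^ 2 + p₀₁ ^ 2) / (p₀₀ * p₀₁) + (p₁₀ ^ 2 + p₁₁ ^ 2) / (p₁₀ * p₁₁))) := by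
  have ha : 0 < p₀₀ * p₀₁ := mul_pos h₀₀ h₀₁
  have hb : 0 < p₁₀ * p₁₁ := mul_pos h₁₀ h₁₁
  have hsum : (p₀₀ ^ 2 + p₀₁ ^ 2) / (p₀₀ * p₀₁) + (p₁₀ ^ 2 + p₁₁ ^ 2) / (p₁₀ * p₁₁) =
      (p₀₀ ^ 2 + p₀₁ ^ 2 + p₀₀ * p₀₁ * α) / (p₀₀ * p₀₁) +
        (p₁₀ ^ 2 + p₁₁ ^ 2 - p₁₀ * p₁₁ * α) / (p₁₀ * p₁₁) := by
    field_simp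
    ring
  rw [hsum]
  refine ⟨Real.sqrt_add_sqrt_le_sqrt_mul_sqrt_div_add_div ha hb hr₁ hr₂, fun hα =>
    Real.sqrt_add_sqrt_eq_sqrt_mul_sqrt_div_add_div ha hb hr₁ ?_⟩
  rw [eq_div_iff (by positivity)] at hα
  linear_combination hα
end

section
/- Let p₀₀, p₀₁, p₁₀, p₁₁ ≥ 0 with Σ_{j,k} p_{jk} = 1. For all ε₀, ε₁, δ₀, δ₁ ∈ {−1, 1}, one has 4·|Σ_{j,k ∈ {0,1}} (−1)^{j·k} p_{jk} ε_j δ_k| ≤ 4 − 8·min{p₀₀, p₀₁, p₁₀, p₁₁}; moreover there exist ε₀, ε₁, δ₀, δ₁ ∈ {−1, 1} attaining equality. Thus the maximal weighted CHSH value of a deterministic strategy is S_D^max(p̄) = 4 − 8·p_min. -/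
/-- the maximal weighted CHSH value of a deterministic strategy
with setting probabilities `p_{jk}` is `S_D^max(p̄) = 4 - 8·min{p₀₀,p₀₁,p₁₀,p₁₁}`:
every deterministic strategy obeys this bound, and some deterministic strategy
attains it. -/
theorem deterministic_weighted_chsh (p₀₀ p₀₁ p₁₀ p₁₁ : ℝ)
    (h₀₀ : 0 ≤ p₀₀) (h₀₁ : 0 ≤ p₀₁) (h₁₀ : 0 ≤ p₁₀) (h₁₁ : 0 ≤ p₁₁)
    (hsum : p₀₀ + p₀₁ + p₁₀ + p₁₁ = 1) :
    (∀ ε₀ ε₁ δ₀ δ₁ : ℝ, (ε₀ = -1 ∨ ε₀ = 1) → (ε₁ = -1 ∨ ε₁ = 1) →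
      (δ₀ = -1 ∨ δ₀ = 1) → (δ₁ = -1 ∨ δ₁ = 1) →
      4 * |p₀₀ * ε₀ * δ₀ + p₀₁ * ε₀ * δ₁ + p₁₀ * ε₁ * δ₀ - p₁₁ * ε₁ * δ₁| ≤
        4 - 8 * min (min p₀₀ p₀₁) (min p₁₀ p₁₁)) ∧
    (∃ ε₀ ε₁ δ₀ δ₁ : ℝ, (ε₀ = -1 ∨ ε₀ = 1) ∧ (ε₁ = -1 ∨ ε₁ = 1) ∧
      (δ₀ = -1 ∨ δ₀ = 1) ∧ (δ₁ = -1 ∨ δ₁ = 1) ∧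
      4 * |p₀₀ * ε₀ * δ₀ + p₀₁ * ε₀ * δ₁ + p₁₀ * ε₁ * δ₀ - p₁₁ * ε₁ * δ₁| =
        4 - 8 * min (min p₀₀ p₀₁) (min p₁₀ p₁₁)) := by
  obtain ⟨m, hm⟩ : ∃ m, m = min (min p₀₀ p₀₁) (min p₁₀ p₁₁) := ⟨_, rfl⟩
  have hm₀₀ : m ≤ p₀₀ := by simp [hm]
  have hm₀₁ : m ≤ p₀₁ := by simp [hm]
  have hm₁₀ : m ≤ p₁₀ := by simp [hm]
  have hm₁₁ : m ≤ p₁₁ := by simp [hm]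
  have hmem : m = p₀₀ ∨ m = p₀₁ ∨ m = p₁₀ ∨ m = p₁₁ := by grind
  rw [← hm]
  constructor
  · rintro _ _ _ _ (rfl | rfl) (rfl | rfl) (rfl | rfl) (rfl | rfl) <;>
      rw [← le_div_iff₀' (by norm_num), abs_le] <;> constructor <;> linarith
  · rcases hmem with h | h | h | h
    · refine ⟨1, -1, -1, 1, by simp, by simp, by simp, by simp, ?_⟩
      rw [abs_of_nonneg] <;> linarith
    · refine ⟨1, 1, 1, -1, by simp, by simp, by simp, by simp, ?_⟩
      rw [abs_of_nonneg] <;> linarith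
    · refine ⟨1, -1, 1, 1, by simp, by simp, by simp, by simp, ?_⟩
      rw [abs_of_nonneg] <;> linarith
    · refine ⟨1, 1, 1, 1, by simp, by simp, by simp, by simp, ?_⟩
      rw [abs_of_nonneg] <;> linarith
end

section
/- Let p₀₀, p₀₁, p₁₀, p₁₁ > 0, let p_min := min{p₀₀, p₀₁, p₁₀, p₁₁}, and suppose 1/p₀₀ + 1/p₀₁ + 1/p₁₀ + 1/p₁₁ − 2/p_min < 0. Then the number α* := [p₀₀²p₀₁²(p₁₀² + p₁₁²) − p₁₀²p₁₁²(p₀₀² + p₀₁²)] / [p₀₀p₀₁p₁₀p₁₁(p₀₀p₀₁ + p₁₀p₁₁)] satisfies |α*| > 2. -/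
/-- The optimal anticommutator value in terms of the reciprocal weights. -/
theorem alpha_eq_inv {p q r s : ℝ} (hp : 0 < p) (hq : 0 < q) (hr : 0 < r) (hs : 0 < s) :
    (p ^ 2 * q ^ 2 * (r ^ 2 + s ^ 2) - r ^ 2 * s ^ 2 * (p ^ 2 + q ^ 2)) /
        (p * q * r * s * (p * q + r * s)) =
      ((1 / r) ^ 2 + (1 / s) ^ 2 - (1 / p) ^ 2 - (1 / q) ^ 2) /
        ((1 / p) * (1 / q) + (1 / r) * (1 / s)) := by
  have hinv : (1 / p) * (1 / q) + (1 / r) * (1 / s) ≠ 0 := by positivity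
  rw [div_eq_div_iff (by positivity) hinv]
  field_simp
  ring

/-- If one of four positive reals exceeds the sum of the others, the quotient
`(c² + d² - a² - b²) / (ab + cd)` has absolute value greater than `2`. -/
theorem two_lt_abs_div_of_sum_lt {a b c d m : ℝ} (ha : 0 < a) (hb : 0 < b) (hc : 0 < c)
    (hd : 0 < d) (hm : m = a ∨ m = b ∨ m = c ∨ m = d) (h : a + b + c + d < 2 * m) :
    2 < |(c ^ 2 + d ^ 2 - a ^ 2 - b ^ 2) / (a * b + c * d)| := by
  have hden : 0 < a * b + c * d := by positivity
  rw [abs_div, abs_of_pos hden, lt_div_iff₀ hden, lt_abs]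
  rcases hm with rfl | rfl | rfl | rfl
  · right; nlinarith
  · right; nlinarith
  · left; nlinarith
  · left; nlinarith

/-- if `1/p₀₀ + 1/p₀₁ + 1/p₁₀ + 1/p₁₁ - 2/p_min < 0` for positive
`p_{jk}` with `p_min` the least of them, then the optimal anticommutator value
`α* = [p₀₀²p₀₁²(p₁₀²+p₁₁²) - p₁₀²p₁₁²(p₀₀²+p₀₁²)] / [p₀₀p₀₁p₁₀p₁₁(p₀₀p₀₁+p₁₀p₁₁)]`
is infeasible: `|α*| > 2`. -/
theorem abs_alpha_gt_two (p₀₀ p₀₁ p₁₀ p₁₁ : ℝ)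
    (h₀₀ : 0 < p₀₀) (h₀₁ : 0 < p₀₁) (h₁₀ : 0 < p₁₀) (h₁₁ : 0 < p₁₁)
    (hcond : 1 / p₀₀ + 1 / p₀₁ + 1 / p₁₀ + 1 / p₁₁ -
        2 / min (min p₀₀ p₀₁) (min p₁₀ p₁₁) < 0) :
    |(p₀₀ ^ 2 * p₀₁ ^ 2 * (p₁₀ ^ 2 + p₁₁ ^ 2) - p₁₀ ^ 2 * p₁₁ ^ 2 * (p₀₀ ^ 2 + p₀₁ ^ 2)) /
        (p₀₀ * p₀₁ * p₁₀ * p₁₁ * (p₀₀ * p₀₁ + p₁₀ * p₁₁))| > 2 := by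
  rw [alpha_eq_inv h₀₀ h₀₁ h₁₀ h₁₁]
  refine two_lt_abs_div_of_sum_lt (m := 1 / min (min p₀₀ p₀₁) (min p₁₀ p₁₁))
    (by positivity) (by positivity) (by positivity) (by positivity) ?_ ?_
  · rcases min_choice (min p₀₀ p₀₁) (min p₁₀ p₁₁) with h | h <;> rw [h]
    · rcases min_choice p₀₀ p₀₁ with h | h <;> simp [h]
    · rcases min_choice p₁₀ p₁₁ with h | h <;> simp [h]
  · rw [mul_one_div]
    linarith
end
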